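/- arXiv:1709.02377 — 2 statements merged into one kernel-verified Lean document; each statement's English description precedes it below -/
import Mathlib

section
/- Let S be a finite nonempty multiset of integers and let k ∈ {1,…,|S|}. Then rank_{rank_S(ℤ)}(k − 1) = 1 + |{q ∈ ⟨S⟩ : rank_S(q) < k}|; that is, if S is presented in sorted order and partitioned into maximal ranges of occurrences of the same value, rank_{rank_S(ℤ)}(k − 1) is one more than the number of ranges that end strictly before the k-th position. -/
/-- `mrank S j` is the rank of `j` in the multiset `S` of integers:
the number of elements of `S` (counted with multiplicity) that are at most `j`. -/
def mrank (S : Multiset ℤ) (j : ℤ) : ℕ := (S.filter (· ≤ j)).card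

/-- `mselect S k` is the select operation: the least `j : ℤ` with `k ≤ mrank S j`. -/
noncomputable def mselect (S : Multiset ℤ) (k : ℤ) : ℤ := sInf {j : ℤ | k ≤ (mrank S j : ℤ)}

/-- `srank A j` is the rank of `j` in the (simple) set `A` of integers. -/
noncomputable def srank (A : Set ℤ) (j : ℤ) : ℕ := {i ∈ A | i ≤ j}.ncard

/-- `sselect A k` is the select operation for a set of integers. -/
noncomputable def sselect (A : Set ℤ) (k : ℤ) : ℤ := sInf {j : ℤ | k ≤ (srank A j : ℤ)}

/-- The support `⟨S⟩` of a multiset of integers, as a set. -/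
def msupp (S : Multiset ℤ) : Set ℤ := {x | x ∈ S}

/-- `rank_S(ℤ)`: the image of the function `mrank S`, as a set of integers. -/
def rankImage (S : Multiset ℤ) : Set ℤ := Set.range fun j : ℤ => (mrank S j : ℤ)

/-- A grouping function: a nondecreasing `g : ℤ → ℤ` all of whose fibers are finite. -/
def GroupingFunction (g : ℤ → ℤ) : Prop := Monotone g ∧ ∀ q : ℤ, (g ⁻¹' {q}).Finite


theorem mrank_pos {S : Multiset ℤ} {q : ℤ} (hq : q ∈ S) : 0 < mrank S q :=
  Multiset.card_pos_iff_exists_mem.mpr ⟨q, Multiset.mem_filter.mpr ⟨hq, le_rfl⟩⟩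

theorem mrank_lt_mrank {S : Multiset ℤ} {p q : ℤ} (hq : q ∈ S) (hpq : p < q) :
    mrank S p < mrank S q := by
  refine Multiset.card_lt_card (lt_of_le_of_ne
    (Multiset.monotone_filter_right S fun _ h => h.trans hpq.le) fun h => ?_)
  have hmem : q ∈ S.filter (· ≤ p) := h ▸ Multiset.mem_filter.mpr ⟨hq, le_rfl⟩
  exact hpq.not_ge (Multiset.mem_filter.mp hmem).2

theorem mrank_injOn_msupp (S : Multiset ℤ) :
    Set.InjOn (fun q : ℤ => (mrank S q : ℤ)) (msupp S) := by
  intro p hp q hq h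
  have h' : mrank S p = mrank S q := Nat.cast_injective h
  rcases lt_trichotomy p q with hlt | heq | hgt
  · exact absurd h' (mrank_lt_mrank hq hlt).ne
  · exact heq
  · exact absurd h' (mrank_lt_mrank hp hgt).ne'

theorem exists_mem_mrank_eq {S : Multiset ℤ} {j : ℤ} (hj : mrank S j ≠ 0) :
    ∃ q ∈ S, mrank S q = mrank S j := by
  obtain ⟨a, ha⟩ := Multiset.card_pos_iff_exists_mem.mp (Nat.pos_of_ne_zero hj)
  obtain ⟨q, hq, hmax⟩ := (S.filter (· ≤ j)).toFinset.exists_max_image id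
    ⟨a, Multiset.mem_toFinset.mpr ha⟩
  simp only [Multiset.mem_toFinset, Multiset.mem_filter, id] at hq hmax
  refine ⟨q, hq.1, congrArg Multiset.card (Multiset.filter_congr fun x hx => ?_)⟩
  exact ⟨fun h => h.trans hq.2, fun h => hmax x ⟨hx, h⟩⟩

theorem exists_mrank_eq_zero (S : Multiset ℤ) : ∃ j, mrank S j = 0 := by
  obtain ⟨b, hb⟩ := S.toFinset.bddBelow
  refine ⟨b - 1, ?_⟩
  simp only [mrank, Multiset.card_eq_zero, Multiset.filter_eq_nil]
  intro x hx h
  have : b ≤ x := hb (by simpa using hx)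
  omega

theorem rankImage_eq_insert (S : Multiset ℤ) :
    rankImage S = insert 0 ((fun q : ℤ => (mrank S q : ℤ)) '' msupp S) := by
  ext i
  constructor
  · rintro ⟨j, rfl⟩
    by_cases hj : mrank S j = 0
    · exact Or.inl (by simp [hj])
    · obtain ⟨q, hq, h⟩ := exists_mem_mrank_eq hj
      exact Or.inr ⟨q, hq, by simp [h]⟩
  · rintro (rfl | ⟨q, -, rfl⟩)
    · obtain ⟨j, hj⟩ := exists_mrank_eq_zero S
      exact ⟨j, by simp [hj]⟩
    · exact ⟨q, rfl⟩

theorem stmt8 (S : Multiset ℤ) (hS : S ≠ 0)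
    (k : ℤ) (hk1 : 1 ≤ k) (hk2 : k ≤ (Multiset.card S : ℤ)) :
    srank (rankImage S) (k - 1) = 1 + {q ∈ msupp S | (mrank S q : ℤ) < k}.ncard := by
  have hfin : {q ∈ msupp S | (mrank S q : ℤ) < k}.Finite :=
    S.toFinset.finite_toSet.subset fun _ hq => Multiset.mem_toFinset.mpr hq.1
  have hset : {i ∈ rankImage S | i ≤ k - 1} =
      insert 0 ((fun q : ℤ => (mrank S q : ℤ)) '' {q ∈ msupp S | (mrank S q : ℤ) < k}) := by
    rw [rankImage_eq_insert]
    ext i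
    constructor
    · rintro ⟨rfl | ⟨q, hq, rfl⟩, hi⟩
      · exact Or.inl rfl
      · exact Or.inr ⟨q, ⟨hq, Int.lt_of_le_sub_one hi⟩, rfl⟩
    · rintro (rfl | ⟨q, ⟨hq, hlt⟩, rfl⟩)
      · exact ⟨Or.inl rfl, by omega⟩
      · exact ⟨Or.inr ⟨q, hq, rfl⟩, Int.le_sub_one_of_lt hlt⟩
  have hzero : (0 : ℤ) ∉
      (fun q : ℤ => (mrank S q : ℤ)) '' {q ∈ msupp S | (mrank S q : ℤ) < k} := by
    rintro ⟨q, hq, h⟩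
    exact (mrank_pos hq.1).ne' (Nat.cast_eq_zero.mp h)
  rw [srank, hset, Set.ncard_insert_of_notMem hzero (hfin.image _),
    ((mrank_injOn_msupp S).mono fun _ h => h.1).ncard_image, add_comm]
end

section
/- Let g : ℤ → ℤ be a grouping function, let S be a finite multiset of integers, let j ∈ ℤ, and set q = g(j). Then rank_S(j) = select_{rank_{g⟦S⟧}(ℤ)}(rank_{g(S)}(q − 1) + 1) + rank_{S ∩ g⁻¹(q)}(j). -/
theorem mrank_mono (T : Multiset ℤ) : Monotone (mrank T) := fun _ _ h =>
  Multiset.card_le_card (Multiset.monotone_filter_right T fun _ hb => hb.trans h)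

theorem mrank_lt_of_mem {T : Multiset ℤ} {s t : ℤ} (ht : t ∈ T) (h : s < t) :
    mrank T s < mrank T t := by
  refine Multiset.card_lt_card (lt_of_le_of_ne
    (Multiset.monotone_filter_right T fun _ hb => hb.trans h.le) fun he => ?_)
  have hm : t ∈ T.filter (· ≤ t) := Multiset.mem_filter.2 ⟨ht, le_rfl⟩
  rw [← he] at hm
  exact absurd (Multiset.mem_filter.1 hm).2 (not_le.2 h)

theorem mrank_eq_zero_or_exists_mem (T : Multiset ℤ) (t : ℤ) :
    mrank T t = 0 ∨ ∃ s ∈ T, s ≤ t ∧ mrank T s = mrank T t := by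
  rcases Finset.eq_empty_or_nonempty (T.filter (· ≤ t)).toFinset with he | hne
  · left
    rw [Multiset.toFinset_eq_empty] at he
    simp [mrank, he]
  · right
    obtain ⟨m, hm, hmax⟩ := Finset.exists_max_image _ id hne
    simp only [Multiset.mem_toFinset, Multiset.mem_filter, id] at hm hmax
    refine ⟨m, hm.1, hm.2, congrArg Multiset.card (Multiset.filter_congr fun x hx => ?_)⟩
    exact ⟨fun h => h.trans hm.2, fun h => hmax x ⟨hx, h⟩⟩

theorem rankImage_inter_Iic (T : Multiset ℤ) (p : ℤ) :
    {a ∈ rankImage T | a ≤ (mrank T p : ℤ)} =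
      insert 0 ((fun t => (mrank T t : ℤ)) '' {t ∈ msupp T | t ≤ p}) := by
  ext a
  simp only [rankImage, Set.mem_ofPred_eq, Set.mem_range, Set.mem_insert_iff, Set.mem_image, msupp]
  constructor
  · rintro ⟨⟨t, rfl⟩, hle⟩
    rcases mrank_eq_zero_or_exists_mem T t with h | ⟨s, hs, -, he⟩
    · left; exact_mod_cast h
    · refine Or.inr ⟨s, ⟨hs, ?_⟩, by rw [he]⟩
      by_contra! hlt
      have := mrank_lt_of_mem hs hlt
      omega
  · rintro (rfl | ⟨t, ⟨-, ht⟩, rfl⟩)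
    · refine ⟨?_, by positivity⟩
      obtain ⟨b, hb⟩ := T.toFinset.finite_toSet.bddBelow
      refine ⟨b - 1, ?_⟩
      have : T.filter (· ≤ b - 1) = 0 := Multiset.filter_eq_nil.2 fun x hx hle => by
        have := hb (Finset.mem_coe.2 (Multiset.mem_toFinset.2 hx))
        omega
      exact congrArg (fun U : Multiset ℤ => (U.card : ℤ)) this
    · exact ⟨⟨t, rfl⟩, by exact_mod_cast mrank_mono T ht⟩

theorem msupp_finite (T : Multiset ℤ) : (msupp T).Finite :=
  T.toFinset.finite_toSet.subset fun _ hx => Finset.mem_coe.2 (Multiset.mem_toFinset.2 hx)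

theorem srank_rankImage (T : Multiset ℤ) (p : ℤ) :
    srank (rankImage T) (mrank T p) = srank (msupp T) p + 1 := by
  have hfin : {t ∈ msupp T | t ≤ p}.Finite := (msupp_finite T).subset fun _ h => h.1
  rw [srank, rankImage_inter_Iic, Set.ncard_insert_of_notMem _ (hfin.image _),
    Set.InjOn.ncard_image, srank]
  · intro s hs t ht he
    have he : mrank T s = mrank T t := Int.ofNat_inj.1 he
    rcases lt_trichotomy s t with h | h | h
    · exact absurd he (mrank_lt_of_mem ht.1 h).ne
    · exact h
    · exact absurd he (mrank_lt_of_mem hs.1 h).ne'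
  · rintro ⟨t, ⟨ht, -⟩, h0⟩
    have := mrank_lt_of_mem ht (sub_one_lt t)
    simp only at h0
    omega

theorem sselect_rankImage (T : Multiset ℤ) (p : ℤ) :
    sselect (rankImage T) ((srank (msupp T) p : ℤ) + 1) = mrank T p := by
  have hfin : {a ∈ rankImage T | a ≤ (mrank T p : ℤ)}.Finite := by
    rw [rankImage_inter_Iic]
    exact (((msupp_finite T).subset fun _ h => h.1).image _).insert _
  have hcard := srank_rankImage T p
  refine IsLeast.csInf_eq ⟨by simp [hcard], fun k hk => ?_⟩
  by_contra! hlt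
  have : srank (rankImage T) k < srank (rankImage T) (mrank T p) :=
    Set.ncard_lt_ncard ⟨fun a ha => ⟨ha.1, ha.2.trans hlt.le⟩, fun hsub =>
      absurd (hsub ⟨⟨p, rfl⟩, le_rfl⟩ : _ ∈ {a ∈ rankImage T | a ≤ k}).2 (not_le.2 hlt)⟩ hfin
  have hk : (srank (msupp T) p : ℤ) + 1 ≤ srank (rankImage T) k := hk
  omega

theorem mrank_eq_mrank_map_add {g : ℤ → ℤ} (hg : Monotone g) (S : Multiset ℤ) (j : ℤ) :
    mrank S j = mrank (S.map g) (g j - 1) + mrank (S.filter fun i => g i = g j) j := by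
  simp only [mrank, Multiset.filter_map, Multiset.card_map, Multiset.filter_filter,
    ← Multiset.countP_eq_card_filter]
  induction S using Multiset.induction_on with
  | empty => simp
  | cons a S ih =>
    simp only [Multiset.countP_cons, ih, Function.comp]
    have h1 : a ≤ j → g a ≤ g j := fun h => hg h
    have h2 : g a < g j → a ≤ j := fun h => (hg.reflect_lt h).le
    split_ifs <;> omega

theorem msupp_map (g : ℤ → ℤ) (S : Multiset ℤ) : msupp (S.map g) = g '' msupp S := by
  ext x
  simp [msupp]

theorem stmt16 (g : ℤ → ℤ) (hg : GroupingFunction g) (S : Multiset ℤ) (j : ℤ) :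
    (mrank S j : ℤ) =
      sselect (rankImage (S.map g)) ((srank (g '' msupp S) (g j - 1) : ℤ) + 1) +
        (mrank (S.filter fun i => g i = g j) j : ℤ) := by
  rw [← msupp_map, sselect_rankImage]
  exact_mod_cast mrank_eq_mrank_map_add hg.1 S j
end
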